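/- For a ring R the following are equivalent: (1) the left regular action of the group of units Rˣ on R (by left multiplication) has finitely many orbits; (2) R has only finitely many left ideals; (3) R is isomorphic as a ring to a direct product F × R₁ × ⋯ × R_k, where F is a finite ring and each Rᵢ is a left artinian ring whose left ideals are totally ordered by inclusion. -/

import Mathlib

/-!
STATEMENT 7 (Hirano): For a ring `R` the following are equivalent:
(1) the left regular action of `Rˣ` on `R` has finitely many orbits;
(2) `R` has only finitely many left ideals;
(3) `R ≅ F × R₁ × ⋯ × R_k` with `F` a finite ring and each `Rᵢ` a left artinian
    ring whose left ideals are totally ordered by inclusion (left uniserial).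
-/

universe u

section FinitelyManyLeftIdeals

variable {S : Type*} [Ring S] [Finite (Submodule S S)]

theorem isNilpotent_or_isUnit_of_idempotents_trivial
    (h : ∀ f : S, IsIdempotentElem f → f = 0 ∨ f = 1) (a : S) : IsNilpotent a ∨ IsUnit a := by
  have : IsArtinianRing S := Finite.to_wellFoundedLT (α := Submodule S S)
  let ρ : Module.End S S := LinearMap.toSpanSingleton S S a
  have hρ : ∀ (n : ℕ) (s : S), (ρ ^ n) s = s * a ^ n := by
    intro n
    induction n with
    | zero => simp
    | succ n ih => intro s; rw [pow_succ', Module.End.mul_apply, ih]; simp [ρ, pow_succ, mul_assoc]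
  obtain ⟨n, hn, hn0⟩ := (ρ.eventually_isCompl_ker_pow_range_pow.and
    (Filter.eventually_ge_atTop 1)).exists
  obtain ⟨k, hk, r, hr, hkr⟩ := Submodule.mem_sup.mp
    ((Submodule.eq_top_iff'.mp hn.sup_eq_top) (1 : S))
  have hk_r : k * r = 0 := by
    refine (Submodule.mem_bot S).mp (hn.inf_eq_bot ▸ ⟨?_, Submodule.smul_mem _ k hr⟩)
    have : k * r = k - k * k := by rw [eq_sub_iff_add_eq', ← mul_add, hkr, mul_one]
    rw [this]
    exact sub_mem hk (Submodule.smul_mem _ k hk)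
  have hk_idem : IsIdempotentElem k := by
    have := congrArg (k * ·) hkr
    simpa [mul_add, hk_r, IsIdempotentElem] using this
  rcases h k hk_idem with rfl | rfl
  · right
    obtain ⟨s, hs⟩ := hr
    rw [hρ] at hs
    have hs1 : s * a ^ n = 1 := by rw [hs]; simpa using hkr
    have : IsUnit (a ^ n) := .of_mul_eq_one s (mul_eq_one_symm hs1)
    exact (isUnit_pow_iff (by omega)).mp this
  · left
    refine ⟨n, ?_⟩
    have := LinearMap.mem_ker.mp hk
    simpa [hρ] using this

/-- In a ring all of whose elements are nilpotent or invertible, the nilpotent elements form a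
left ideal. -/
def nilpotentLeftIdeal (S : Type*) [Ring S] [IsDedekindFiniteMonoid S] [Nontrivial S]
    (h : ∀ a : S, IsNilpotent a ∨ IsUnit a) : Submodule S S where
  carrier := {a | IsNilpotent a}
  zero_mem' := IsNilpotent.zero
  smul_mem' := by
    intro r a ha
    refine (h (r * a)).resolve_right fun hu => ha.not_isUnit ?_
    exact isUnit_of_mul_isUnit_right hu
  add_mem' := by
    intro a b ha hb
    refine (h (a + b)).resolve_right ?_
    rintro ⟨u, hu⟩
    have key : ∀ c : S, IsNilpotent c → IsNilpotent ((↑u⁻¹ : S) * c) := fun c hc =>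
      (h _).resolve_right fun hu => hc.not_isUnit (isUnit_of_mul_isUnit_right hu)
    have e : 1 - (↑u⁻¹ : S) * a = ↑u⁻¹ * b := by
      rw [← u.inv_mul, hu]; noncomm_ring
    exact (key b hb).not_isUnit (e ▸ (key a ha).isUnit_one_sub)

theorem finite_of_finite_quotient_nilpotent [Nontrivial S]
    [IsDedekindFiniteMonoid S]
    (h : ∀ a : S, IsNilpotent a ∨ IsUnit a) [Finite (S ⧸ nilpotentLeftIdeal S h)] : Finite S := by
  set J := nilpotentLeftIdeal S h
  suffices ∀ N : Submodule S S, (N : Set S).Finite from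
    Set.finite_univ_iff.mp (by simpa using this ⊤)
  intro N
  induction N using WellFoundedLT.induction with
  | ind N ih =>
  by_cases hN : ∃ x ∈ N, Submodule.span S {x} = N
  · obtain ⟨x, -, rfl⟩ := hN
    by_cases hx : x = 0
    · simp [hx]
    have hlt : J.map (LinearMap.toSpanSingleton S S x) < Submodule.span S {x} := by
      refine lt_of_le_of_ne ?_ ?_
      · rw [Submodule.map_le_iff_le_comap]
        intro s _
        exact Submodule.smul_mem _ s (Submodule.mem_span_singleton_self x)
      · intro heq
        have hmem := heq.symm ▸ Submodule.mem_span_singleton_self x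
        obtain ⟨j, hj : IsNilpotent j, hjx⟩ := hmem
        have : (1 - j) * x = 0 := by
          have hjx : j * x = x := hjx
          rw [sub_mul, hjx, one_mul, sub_self]
        exact hx (hj.isUnit_one_sub.mul_right_eq_zero.mp this)
    refine (Set.finite_iUnion fun q : S ⧸ J => (ih _ hlt).image (q.out * x + ·)).subset ?_
    intro y hy
    obtain ⟨s, rfl⟩ := Submodule.mem_span_singleton.mp hy
    refine Set.mem_iUnion.mpr ⟨Submodule.Quotient.mk s,
      (s - (Submodule.Quotient.mk s : S ⧸ J).out) * x, ⟨_, ?_, rfl⟩, ?_⟩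
    · exact (Submodule.Quotient.eq J).mp (Quotient.out_eq' (Submodule.Quotient.mk s : S ⧸ J)).symm
    · simp [sub_mul]
  · push Not at hN
    refine (Set.finite_iUnion fun M : {M : Submodule S S // M < N} => ih M M.2).subset ?_
    intro x hx
    exact Set.mem_iUnion.mpr ⟨⟨Submodule.span S {x}, lt_of_le_of_ne
      (Submodule.span_le.mpr (by simpa using hx)) (hN x hx)⟩, Submodule.mem_span_singleton_self x⟩

/-- A local ring with infinitely many elements that are pairwise distinct modulo the maximal
ideal. -/
structure HasInfiniteResidue (S : Type*) [Ring S] : Prop extends IsLocalRing S where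
  exists_infinite : ∃ U : Set S, U.Infinite ∧ U.Pairwise fun s t => IsUnit (s - t)

theorem HasInfiniteResidue.of_idempotents_trivial [Infinite S]
    (h : ∀ f : S, IsIdempotentElem f → f = 0 ∨ f = 1) : HasInfiniteResidue S := by
  have : IsArtinianRing S := Finite.to_wellFoundedLT (α := Submodule S S)
  have h' := isNilpotent_or_isUnit_of_idempotents_trivial h
  have hinf : Infinite (S ⧸ nilpotentLeftIdeal S h') :=
    not_finite_iff_infinite.mp fun _ => not_finite_iff_infinite.mpr ‹Infinite S›
      (finite_of_finite_quotient_nilpotent h')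
  refine { IsLocalRing.of_isUnit_or_isUnit_one_sub_self fun a =>
    (h' a).symm.imp_right IsNilpotent.isUnit_one_sub with exists_infinite := ?_ }
  refine ⟨Set.range (Quotient.out : S ⧸ nilpotentLeftIdeal S h' → S),
    Set.infinite_range_of_injective Quotient.out_injective, ?_⟩
  rintro _ ⟨p, rfl⟩ _ ⟨q, rfl⟩ hpq
  refine (h' _).resolve_left fun hn => hpq (congrArg _ ?_)
  rw [← Quotient.out_eq' p, ← Quotient.out_eq' q]
  exact (Submodule.Quotient.eq (nilpotentLeftIdeal S h')).mpr hn

end FinitelyManyLeftIdeals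

section Corner

variable {R : Type*} [Ring R] {e : R}

namespace IsIdempotentElem.Corner

variable {he : IsIdempotentElem e}

theorem mul_coe (s : he.Corner) : e * s.1 = s.1 := ((Subsemigroup.mem_corner_iff he).mp s.2).1

theorem coe_mul (s : he.Corner) : s.1 * e = s.1 := ((Subsemigroup.mem_corner_iff he).mp s.2).2

theorem finite_submodule (he : IsIdempotentElem e) [Finite (Submodule R R)] :
    Finite (Submodule he.Corner he.Corner) := by
  have key : ∀ (I : Submodule he.Corner he.Corner) (x : R),
      x ∈ Submodule.span R (Subtype.val '' (I : Set he.Corner)) →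
        ∀ r : R, (⟨e * (r * x) * e, r * x, rfl⟩ : he.Corner) ∈ I := by
    intro I x hx
    induction hx using Submodule.span_induction with
    | mem x hx =>
      obtain ⟨y, hy, rfl⟩ := hx
      intro r
      refine Set.mem_of_eq_of_mem (Subtype.ext ?_)
        (I.smul_mem (⟨e * r * e, r, rfl⟩ : he.Corner) hy)
      change e * (r * y.1) * e = e * r * e * y.1
      rw [mul_assoc _ e y.1, mul_coe (he := he) y, mul_assoc, mul_assoc r, coe_mul (he := he) y, mul_assoc]
    | zero =>
      intro r
      refine Set.mem_of_eq_of_mem (Subtype.ext ?_) I.zero_mem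
      change e * (r * 0) * e = 0
      simp
    | add x y _ _ hx hy =>
      intro r
      refine Set.mem_of_eq_of_mem (Subtype.ext ?_) (I.add_mem (hx r) (hy r))
      change e * (r * (x + y)) * e = e * (r * x) * e + e * (r * y) * e
      simp only [mul_add, add_mul]
    | smul s x _ hx =>
      intro r
      simpa [mul_assoc] using hx (r * s)
  have key' : ∀ (I : Submodule he.Corner he.Corner) (y : he.Corner),
      y ∈ I ↔ y.1 ∈ Submodule.span R (Subtype.val '' (I : Set he.Corner)) := by
    refine fun I y => ⟨fun hy => Submodule.subset_span ⟨y, hy, rfl⟩, fun hy => ?_⟩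
    refine Set.mem_of_eq_of_mem (Subtype.ext ?_) (key I _ hy 1)
    change y.1 = e * (1 * y.1) * e
    rw [one_mul, mul_coe, coe_mul]
  refine Finite.of_injective (fun I : Submodule he.Corner he.Corner =>
    Submodule.span R (Subtype.val '' (I : Set he.Corner))) fun I I' h => ?_
  ext y
  rw [key', key' I']
  exact iff_of_eq (congrArg (y.1 ∈ ·) h)

end IsIdempotentElem.Corner

open IsIdempotentElem.Corner

variable [Finite (Submodule R R)]

theorem finite_range_mul_left_of_finite_corner (he : IsIdempotentElem e) [Finite he.Corner] :
    (Set.range (e * ·)).Finite := by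
  let fiber (I : Submodule R R) : Set R := {x | e * x = x ∧ Submodule.span R {x} = I}
  have hfiber : ∀ I, (fiber I).Finite := by
    intro I
    rcases (fiber I).eq_empty_or_nonempty with h | ⟨x₀, hx₀, hI⟩
    · simp [h]
    refine (Set.finite_range fun s : he.Corner => s.1 * x₀).subset ?_
    rintro x ⟨hx, hxI⟩
    have : x ∈ Submodule.span R {x₀} := hI ▸ hxI ▸ Submodule.mem_span_singleton_self x
    obtain ⟨r, rfl⟩ := Submodule.mem_span_singleton.mp this
    exact ⟨⟨e * r * e, r, rfl⟩, by simp only [smul_eq_mul, mul_assoc, hx₀] at hx ⊢; exact hx⟩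
  refine (Set.finite_iUnion hfiber).subset ?_
  rintro _ ⟨r, rfl⟩
  refine Set.mem_iUnion.mpr ⟨Submodule.span R {e * r}, ?_, rfl⟩
  simp only [← mul_assoc, he.eq]

theorem exists_smul_eq_of_hasInfiniteResidue {he : IsIdempotentElem e}
    (h : HasInfiniteResidue he.Corner) {x y : R} (hx : e * x = x) (hy : e * y = y) :
    ∃ s : he.Corner, x = s.1 * y ∨ y = s.1 * x := by
  have := h.toIsLocalRing
  have : IsArtinianRing he.Corner :=
    have := finite_submodule he
    Finite.to_wellFoundedLT (α := Submodule he.Corner he.Corner)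
  obtain ⟨U, hU, hUp⟩ := h.exists_infinite
  obtain ⟨s, hs, t, ht, hst, heq⟩ := hU.exists_ne_map_eq_of_mapsTo
    (f := fun s : he.Corner => Submodule.span R {x + s.1 * y}) (fun _ _ => Set.mem_univ _)
    Set.finite_univ
  obtain ⟨u, hu⟩ := hUp hs ht hst
  have hmem : x + t.1 * y ∈ Submodule.span R {x + s.1 * y} := by
    have heq : Submodule.span R {x + s.1 * y} = Submodule.span R {x + t.1 * y} := heq
    exact heq ▸ Submodule.mem_span_singleton_self _
  obtain ⟨r, hr⟩ := Submodule.mem_span_singleton.mp hmem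
  have hes : e * (x + s.1 * y) = x + s.1 * y := by rw [mul_add, hx, ← mul_assoc, mul_coe]
  have het : e * (x + t.1 * y) = x + t.1 * y := by rw [mul_add, hx, ← mul_assoc, mul_coe]
  obtain ⟨c, hc⟩ : ∃ c : he.Corner, c.1 * (x + s.1 * y) = x + t.1 * y := by
    refine ⟨⟨e * r * e, r, rfl⟩, ?_⟩
    simp only [mul_assoc, hes]
    rw [← smul_eq_mul r, hr, het]
  have hval_inv : (↑u⁻¹ : he.Corner).1 * (s.1 - t.1) = e := by
    have := congrArg Subtype.val u.inv_mul
    rw [hu] at this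
    exact this
  obtain ⟨b, hb⟩ : ∃ b : he.Corner, b.1 * (x + s.1 * y) = y := by
    refine ⟨↑u⁻¹ * (1 - c), ?_⟩
    change (↑u⁻¹ : he.Corner).1 * (e - c.1) * (x + s.1 * y) = y
    rw [mul_assoc, sub_mul, hes, hc, add_sub_add_left_eq_sub, ← sub_mul, ← mul_assoc, hval_inv, hy]
  have hb' : b.1 * x = (1 - b * s : he.Corner).1 * y := by
    change b.1 * x = (e - b.1 * s.1) * y
    rw [sub_mul, hy, mul_assoc, eq_sub_iff_add_eq, ← mul_add, hb]
  rcases IsLocalRing.isUnit_or_isUnit_of_add_one (add_sub_cancel (b * s) 1) with hbs | hbs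
  · obtain ⟨v, hv⟩ := isUnit_of_mul_isUnit_left hbs
    have hv' : (↑v⁻¹ : he.Corner).1 * b.1 = e := by
      rw [← hv]; exact congrArg Subtype.val v.inv_mul
    refine ⟨↑v⁻¹ * (1 - b * s), Or.inl ?_⟩
    change x = (↑v⁻¹ : he.Corner).1 * (1 - b * s : he.Corner).1 * y
    rw [mul_assoc, ← hb', ← mul_assoc, hv', hx]
  · obtain ⟨v, hv⟩ := hbs
    have hv' : (↑v⁻¹ : he.Corner).1 * (1 - b * s : he.Corner).1 = e := by
      rw [← hv]; exact congrArg Subtype.val v.inv_mul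
    refine ⟨↑v⁻¹ * b, Or.inr ?_⟩
    change y = (↑v⁻¹ : he.Corner).1 * b.1 * x
    rw [mul_assoc, hb', ← mul_assoc, hv', hy]

theorem HasInfiniteResidue.mul_eq_mul_mul {he : IsIdempotentElem e}
    (h : HasInfiniteResidue he.Corner) (r : R) : e * r = e * r * e := by
  have := h.toIsLocalRing
  have hy : e * (e * r * (1 - e)) = e * r * (1 - e) := by simp only [← mul_assoc, he.eq]
  suffices e * r * (1 - e) = 0 by rwa [mul_sub, mul_one, sub_eq_zero] at this
  have h1 : (1 - e) * e = 0 := he.one_sub_mul_self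
  obtain ⟨s, hs | hs⟩ := exists_smul_eq_of_hasInfiniteResidue h he.eq hy
  · have : e = 0 := by
      rw [← he.eq]
      nth_rw 1 [hs]
      simp only [mul_assoc, h1, mul_zero]
    simp [this]
  · have h2 : e * (1 - e) = 0 := he.mul_one_sub_self
    have h3 : (1 - e) * (1 - e) = 1 - e := he.one_sub.eq
    rw [← h3, ← mul_assoc, hs, coe_mul, ← coe_mul s, mul_assoc, h2, mul_zero]

omit [Finite (Submodule R R)] in
theorem HasInfiniteResidue.mul_mul_eq_zero {he : IsIdempotentElem e}
    (h : HasInfiniteResidue he.Corner) {g : R} (hg : (Set.range (g * ·)).Finite) (r : R) :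
    g * r * e = 0 := by
  obtain ⟨U, hU, hUp⟩ := h.exists_infinite
  obtain ⟨s, hs, t, ht, hst, heq⟩ := hU.exists_ne_map_eq_of_mapsTo
    (f := fun s : he.Corner => g * (r * s.1)) (fun s _ => Set.mem_range_self (r * s.1)) hg
  obtain ⟨u, hu⟩ := hUp hs ht hst
  have hval : (s.1 - t.1) * (↑u⁻¹ : he.Corner).1 = e := by
    have := congrArg Subtype.val u.mul_inv
    rw [hu] at this
    exact this
  have h0 : g * r * (s.1 - t.1) = 0 := by
    rw [mul_sub, sub_eq_zero, mul_assoc, mul_assoc]; exact heq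
  rw [← hval, ← mul_assoc, h0, zero_mul]

theorem exists_hasInfiniteResidue {g : R} (hg : IsIdempotentElem g)
    (hinf : (Set.range (g * ·)).Infinite) :
    ∃ (e : R) (he : IsIdempotentElem e), g * e = e ∧ e * g = e ∧
      HasInfiniteResidue he.Corner := by
  let p : R → Prop := fun e =>
    IsIdempotentElem e ∧ g * e = e ∧ e * g = e ∧ (Set.range (e * ·)).Infinite
  have hwf : WellFounded (InvImage (· < ·) fun e : R => Submodule.span R {e}) :=
    InvImage.wf _ wellFounded_lt
  obtain ⟨e, ⟨he, hge, heg, heinf⟩, hmin⟩ := hwf.has_min {e | p e} ⟨g, hg, hg.eq, hg.eq, hinf⟩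
  have hmin' : ∀ f, IsIdempotentElem f → e * f = f → f * e = f →
      (Set.range (f * ·)).Infinite → f = e := by
    intro f hf hef hfe hfinf
    by_contra hne
    refine hmin f (show p f from ⟨hf, by rw [← hef, ← mul_assoc, hge], by rw [← hfe, mul_assoc, heg], hfinf⟩)
      (lt_of_le_of_ne ?_ fun heq => hne ?_)
    · rw [Submodule.span_singleton_le_iff_mem]
      exact Submodule.mem_span_singleton.mpr ⟨f, hfe⟩
    · obtain ⟨r, hr⟩ := Submodule.mem_span_singleton.mp
        ((Submodule.span_singleton_le_iff_mem _ _).mp heq.ge)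
      rw [← hef, ← hr, smul_eq_mul, mul_assoc, hf.eq]
  have := finite_submodule he
  have : Infinite he.Corner := not_finite_iff_infinite.mp fun _ =>
    heinf (finite_range_mul_left_of_finite_corner he)
  refine ⟨e, he, hge, heg, .of_idempotents_trivial fun f hf => ?_⟩
  have hf' : IsIdempotentElem f.1 := congrArg Subtype.val hf
  by_cases hfin : (Set.range (f.1 * ·)).Finite
  · left
    have hsub : IsIdempotentElem (e - f.1) := by
      simp [IsIdempotentElem, mul_sub, sub_mul, he.eq, hf'.eq, mul_coe, coe_mul]
    have := hmin' (e - f.1) hsub (by rw [mul_sub, he.eq, mul_coe])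
      (by rw [sub_mul, he.eq, coe_mul]) fun hfin' => heinf ?_
    · exact Subtype.ext (sub_eq_self.mp this)
    · refine (hfin.add hfin').subset ?_
      rintro _ ⟨r, rfl⟩
      exact ⟨_, ⟨r, rfl⟩, _, ⟨r, rfl⟩, by simp [sub_mul]⟩
  · exact Or.inr (Subtype.ext (hmin' f.1 hf' (mul_coe f) (coe_mul f) hfin))

end Corner

theorem exists_completeOrthogonalIdempotents_hasInfiniteResidue (R : Type*) [Ring R]
    [Finite (Submodule R R)] :
    ∃ (n : ℕ) (e : Option (Fin n) → R) (he : CompleteOrthogonalIdempotents e),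
      (Set.range (e none * ·)).Finite ∧ ∀ i, HasInfiniteResidue (he.idem (some i)).Corner := by
  let p : R → Prop := fun g => ∃ (n : ℕ) (e : Option (Fin n) → R)
    (he : CompleteOrthogonalIdempotents e), e none = g ∧
      ∀ i, HasInfiniteResidue (he.idem (some i)).Corner
  have hwf : WellFounded (InvImage (· < ·) fun e : R => Submodule.span R {e}) :=
    InvImage.wf _ wellFounded_lt
  obtain ⟨_, ⟨n, e, he, rfl, hres⟩, hmin⟩ := hwf.has_min {g | p g}
    ⟨1, 0, fun _ => 1, CompleteOrthogonalIdempotents.unique_iff.mpr rfl, rfl, fun i => i.elim0⟩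
  refine ⟨n, e, he, ?_, hres⟩
  by_contra hinf
  obtain ⟨f, hf, hgf, hfg, hfres⟩ := exists_hasInfiniteResidue (he.idem none) hinf
  set g := e none with hg
  have hgg : g * g = g := he.idem none
  have hge (i : Fin n) : g * e (some i) = 0 := he.ortho (by simp)
  have heg (i : Fin n) : e (some i) * g = 0 := he.ortho (by simp)
  have hfe (i : Fin n) : f * e (some i) = 0 := by rw [← hfg, mul_assoc, hge, mul_zero]
  have hef (i : Fin n) : e (some i) * f = 0 := by rw [← hgf, ← mul_assoc, heg, zero_mul]
  let e' : Option (Fin (n + 1)) → R := fun o =>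
    o.elim (g - f) fun i => Fin.cases f (fun j => e (some j)) i
  have he' : CompleteOrthogonalIdempotents e' := by
    rw [CompleteOrthogonalIdempotents.iff_ortho_complete]
    constructor
    · have hee {i j : Fin n} (h : i ≠ j) : e (some i) * e (some j) = 0 := he.ortho (by simpa)
      rintro (_ | i) (_ | j) hij
      · exact absurd rfl hij
      · cases j using Fin.cases with
        | zero => simp [e', sub_mul, hgf, hf.eq]
        | succ j => simp [e', sub_mul, hge, hfe]
      · cases i using Fin.cases with
        | zero => simp [e', mul_sub, hfg, hf.eq]
        | succ i => simp [e', mul_sub, heg, hef]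
      · cases i using Fin.cases with
        | zero =>
          cases j using Fin.cases with
          | zero => exact absurd rfl hij
          | succ j => simp [e', hfe]
        | succ i =>
          cases j using Fin.cases with
          | zero => simp [e', hef]
          | succ j => exact hee fun h => hij (congrArg (some ∘ Fin.succ) h)
    · have := he.complete
      rw [Fintype.sum_option] at this ⊢
      rw [Fin.sum_univ_succ, ← this]
      simp [e', hg, ← add_assoc]
  have hf0 : f ≠ 0 := by
    have := hfres.toIsLocalRing
    exact fun h => one_ne_zero (α := hf.Corner) (Subtype.ext h)
  refine hmin (g - f) ⟨n + 1, e', he', rfl, fun i => ?_⟩ (lt_of_le_of_ne ?_ fun heq => ?_)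
  · cases i using Fin.cases with
    | zero => exact hfres
    | succ i => exact hres i
  · rw [Submodule.span_singleton_le_iff_mem]
    exact Submodule.mem_span_singleton.mpr ⟨g - f, by simp [sub_mul, hgg, hfg]⟩
  · obtain ⟨r, hr⟩ := Submodule.mem_span_singleton.mp
      ((Submodule.span_singleton_le_iff_mem _ _).mp heq.ge)
    refine hf0 ?_
    rw [← hgf, ← hr, smul_eq_mul, mul_assoc, sub_mul, hgf, hf.eq, sub_self, mul_zero]

theorem isMulCentral_of_hasInfiniteResidue {R ι : Type*} [Ring R] [Finite (Submodule R R)]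
    [Fintype ι] {e : Option ι → R} (he : CompleteOrthogonalIdempotents e)
    (hfin : (Set.range (e none * ·)).Finite)
    (hres : ∀ i, HasInfiniteResidue (he.idem (some i)).Corner) (o : Option ι) :
    IsMulCentral (e o) := by
  have hsome (i : ι) (r : R) : Commute (e (some i)) r := by
    have h1 := (hres i).mul_eq_mul_mul r
    have h2 : r * e (some i) = e (some i) * r * e (some i) := by
      conv_lhs => rw [← one_mul r, ← he.complete, Finset.sum_mul, Finset.sum_mul]
      refine Finset.sum_eq_single _ (fun o _ ho => ?_) (by simp)
      rcases o with _ | j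
      · exact (hres i).mul_mul_eq_zero hfin r
      · rw [(hres j).mul_eq_mul_mul r, mul_assoc, he.ortho ho, mul_zero]
    exact h1.trans h2.symm
  refine Semigroup.mem_center_iff.mpr fun r => ?_
  rcases o with _ | i
  · have : e none = 1 - ∑ i, e (some i) := by
      rw [eq_sub_iff_add_eq, ← Fintype.sum_option, he.complete]
    rw [this]
    exact ((Commute.one_left r).sub_left
      (Commute.sum_left _ _ _ fun i _ => hsome i r)).symm.eq
  · exact (hsome i r).symm.eq

theorem exists_ringEquiv_of_finite_submodule (R : Type u) [Ring R] [Finite (Submodule R R)] :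
    ∃ (F : Type u) (_ : Ring F) (_ : Finite F) (k : ℕ) (Rs : Fin k → Type u)
      (_ : ∀ i, Ring (Rs i)),
      (∀ i, IsArtinianRing (Rs i)) ∧
      (∀ i, ∀ I J : Ideal (Rs i), I ≤ J ∨ J ≤ I) ∧
      Nonempty (R ≃+* (F × ((i : Fin k) → Rs i))) := by
  obtain ⟨n, e, he, hfin, hres⟩ := exists_completeOrthogonalIdempotents_hasInfiniteResidue R
  refine ⟨(he.idem none).Corner, inferInstance, ?_, n, fun i => (he.idem (some i)).Corner,
    inferInstance, fun i => ?_, fun i I J => ?_, ⟨(he.ringEquivOfIsMulCentral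
      (isMulCentral_of_hasInfiniteResidue he hfin hres)).trans RingEquiv.piOptionEquivProd⟩⟩
  · have := hfin.to_subtype
    refine Finite.of_injective (fun s : (he.idem none).Corner =>
      (⟨s.1, s.1, IsIdempotentElem.Corner.mul_coe s⟩ : Set.range (e none * ·))) fun s t h => ?_
    exact Subtype.ext (Subtype.mk.inj h : s.1 = t.1)
  · have := IsIdempotentElem.Corner.finite_submodule (he.idem (some i))
    exact Finite.to_wellFoundedLT
      (α := Submodule (he.idem (some i)).Corner (he.idem (some i)).Corner)
  · by_contra! h
    obtain ⟨x, hxI, hxJ⟩ := SetLike.not_le_iff_exists.mp h.1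
    obtain ⟨y, hyJ, hyI⟩ := SetLike.not_le_iff_exists.mp h.2
    obtain ⟨s, hs | hs⟩ := exists_smul_eq_of_hasInfiniteResidue (hres i)
      (IsIdempotentElem.Corner.mul_coe x) (IsIdempotentElem.Corner.mul_coe y)
    · exact hxJ ((Subtype.ext hs : x = s * y) ▸ J.mul_mem_left s hyJ)
    · exact hyI ((Subtype.ext hs : y = s * x) ▸ I.mul_mem_left s hxI)

section Uniserial

variable {S : Type*} [Ring S] [IsArtinianRing S]

theorem finite_ideal_of_uniserial (h : ∀ I J : Ideal S, I ≤ J ∨ J ≤ I) : Finite (Ideal S) := by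
  classical
  have : Std.Total (α := Ideal S) (· ≤ ·) := ⟨h⟩
  let _ : LinearOrder (Ideal S) := Lattice.toLinearOrder (Ideal S)
  have : WellFoundedLT (Ideal S) := ‹IsArtinianRing S›
  have : WellFoundedGT (Ideal S) := inferInstance
  exact Finite.of_wellFoundedLT_wellFoundedGT (Ideal S)

theorem exists_units_smul_eq_of_uniserial (h : ∀ I J : Ideal S, I ≤ J ∨ J ≤ I) {x y : S}
    (hxy : Ideal.span {x} = Ideal.span {y}) : ∃ u : Sˣ, u • y = x := by
  obtain ⟨a, rfl⟩ : ∃ a, a * y = x :=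
    Ideal.mem_span_singleton'.mp (hxy ▸ Ideal.mem_span_singleton_self x)
  obtain ⟨b, hb⟩ : ∃ b, b * (a * y) = y :=
    Ideal.mem_span_singleton'.mp (hxy.symm ▸ Ideal.mem_span_singleton_self y)
  have key : ∀ c : S, Ideal.span {c} = ⊤ → IsUnit c := fun c hc => by
    obtain ⟨d, hd⟩ := Ideal.mem_span_singleton'.mp (hc ▸ Submodule.mem_top : (1 : S) ∈ _)
    exact .of_mul_eq_one d (mul_eq_one_symm hd)
  have hsup : Ideal.span {b * a} ⊔ Ideal.span {1 - b * a} = ⊤ := by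
    rw [Ideal.eq_top_iff_one]
    exact Submodule.mem_sup.mpr ⟨_, Ideal.mem_span_singleton_self (b * a), _,
      Ideal.mem_span_singleton_self (1 - b * a), add_sub_cancel (b * a) 1⟩
  rcases h (Ideal.span {b * a}) (Ideal.span {1 - b * a}) with hle | hle
  · have hu := key _ ((sup_eq_right.mpr hle).symm.trans hsup)
    have : y = 0 := hu.mul_right_eq_zero.mp (by rw [sub_mul, mul_assoc, hb, one_mul, sub_self])
    exact ⟨1, by simp [this]⟩
  · obtain ⟨u, hu⟩ := isUnit_of_mul_isUnit_right (key _ ((sup_eq_left.mpr hle).symm.trans hsup))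
    exact ⟨u, by rw [Units.smul_def, hu, smul_eq_mul]⟩

end Uniserial

theorem finite_orbits_of_ringEquiv {R F : Type*} [Ring R] [Ring F] [Finite F] {ι : Type*}
    [Finite ι] {Rs : ι → Type*} [∀ i, Ring (Rs i)] [∀ i, IsArtinianRing (Rs i)]
    (h : ∀ i, ∀ I J : Ideal (Rs i), I ≤ J ∨ J ≤ I) (φ : R ≃+* F × ((i : ι) → Rs i)) :
    Finite (MulAction.orbitRel.Quotient Rˣ R) := by
  have := fun i => finite_ideal_of_uniserial (h i)
  let f : R → F × ((i : ι) → Ideal (Rs i)) := fun x =>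
    ((φ x).1, fun i => Ideal.span {(φ x).2 i})
  refine Finite.of_injective (fun q : MulAction.orbitRel.Quotient Rˣ R => f q.out) fun p q hpq => ?_
  have hpq' : f p.out = f q.out := hpq
  rw [← Quotient.out_eq' p, ← Quotient.out_eq' q]
  refine Quotient.sound' (MulAction.orbitRel_apply.mpr ?_)
  choose u hu using fun i => exists_units_smul_eq_of_uniserial (h i)
    (congrFun (congrArg Prod.snd hpq') i)
  let v : (F × ((i : ι) → Rs i))ˣ := MulEquiv.prodUnits.symm (1, MulEquiv.piUnits.symm u)
  refine ⟨Units.map φ.symm.toMonoidHom v, φ.injective ?_⟩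
  change φ (φ.symm v.1 * q.out) = φ p.out
  rw [map_mul, φ.apply_symm_apply]
  refine Prod.ext ?_ (funext fun i => hu i)
  exact (one_mul _).trans (congrArg Prod.fst hpq').symm

theorem finite_submodule_of_finite_orbits (R : Type*) [Ring R]
    [Finite (MulAction.orbitRel.Quotient Rˣ R)] : Finite (Submodule R R) := by
  refine Finite.of_injective (fun I : Submodule R R =>
    {q : MulAction.orbitRel.Quotient Rˣ R | q.out ∈ I}) fun I J h => ?_
  have key (I : Submodule R R) (x : R) :
      x ∈ I ↔ (Quotient.mk'' x : MulAction.orbitRel.Quotient Rˣ R).out ∈ I := by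
    obtain ⟨u, hu⟩ := MulAction.orbitRel_apply.mp (Quotient.exact'
      (Quotient.out_eq' (Quotient.mk'' x : MulAction.orbitRel.Quotient Rˣ R)))
    rw [← hu]
    exact (Submodule.smul_mem_iff_of_isUnit I u.isUnit).symm
  ext x
  rw [key I, key J]
  exact Set.ext_iff.mp h _

theorem hirano_tfae (R : Type u) [Ring R] :
    List.TFAE
      [Finite (MulAction.orbitRel.Quotient Rˣ R),
       Finite (Submodule R R),
       ∃ (F : Type u) (_ : Ring F) (_ : Finite F) (k : ℕ) (Rs : Fin k → Type u)
         (_ : ∀ i, Ring (Rs i)),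
         (∀ i, IsArtinianRing (Rs i)) ∧
         (∀ i, ∀ I J : Ideal (Rs i), I ≤ J ∨ J ≤ I) ∧
         Nonempty (R ≃+* (F × ((i : Fin k) → Rs i)))] := by
  tfae_have 1 → 2 := fun _ => finite_submodule_of_finite_orbits R
  tfae_have 2 → 3 := fun _ => exists_ringEquiv_of_finite_submodule R
  tfae_have 3 → 1 := fun ⟨_, _, _, _, _, _, _, h, ⟨φ⟩⟩ => finite_orbits_of_ringEquiv h φ
  tfae_finish
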